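/- arXiv:1610.08209 — 5 statements merged into one kernel-verified Lean document; each statement's English description precedes it below -/
import Mathlib

section
/- For every n ≥ 1 and every integer r with 0 ≤ r ≤ n − 1, the Gårding cone Γ_r ⊂ ℝⁿ is a convex set and the quotient Q_{r+1} = E_{r+1}/E_r is a concave function on Γ_r. -/
/-- The `r`-th elementary symmetric function of `x ∈ ℝⁿ`, with `E_0 = 1` and `E_r = 0` for `r > n`. -/
noncomputable def esymmE (n r : ℕ) (x : Fin n → ℝ) : ℝ :=
  ∑ s ∈ (Finset.univ : Finset (Fin n)).powersetCard r, ∏ j ∈ s, x j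

/-- The Gårding cone `Γ_r = {λ ∈ ℝⁿ : E_i(λ) > 0, i = 1,…,r}` (so `Γ_0 = ℝⁿ`). -/
def gardingCone (n r : ℕ) : Set (Fin n → ℝ) :=
  {x | ∀ k : ℕ, 1 ≤ k → k ≤ r → 0 < esymmE n k x}

lemma esymmE_zero (n : ℕ) (x : Fin n → ℝ) : esymmE n 0 x = 1 := by
  simp [esymmE]

lemma esymmE_update_zero (n k : ℕ) (x : Fin n → ℝ) (i : Fin n) :
    esymmE n k (Function.update x i 0) =
      ∑ s ∈ (Finset.univ : Finset (Fin n)).powersetCard k, if i ∈ s then 0 else ∏ j ∈ s, x j := by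
  refine Finset.sum_congr rfl fun s _ => ?_
  split_ifs with h
  · exact Finset.prod_eq_zero h (by simp)
  · exact Finset.prod_congr rfl fun j hj =>
      Function.update_of_ne (fun hji : j = i => h (hji ▸ hj)) _ _

lemma esymmE_succ_eq (n k : ℕ) (x : Fin n → ℝ) (i : Fin n) :
    esymmE n (k + 1) x = x i * esymmE n k (Function.update x i 0) +
      esymmE n (k + 1) (Function.update x i 0) := by
  have hU : (Finset.univ : Finset (Fin n)) = insert i (Finset.univ.erase i) :=
    (Finset.insert_erase (Finset.mem_univ i)).symm
  have notMem_of_mem : ∀ m, ∀ s ∈ (Finset.univ.erase i).powersetCard m, i ∉ s := fun m s hs hi =>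
    Finset.notMem_erase i _ ((Finset.mem_powersetCard.1 hs).1 hi)
  have expand : ∀ m, ∀ y : Fin n → ℝ, esymmE n (m + 1) y =
      ∑ s ∈ (Finset.univ.erase i).powersetCard (m + 1), ∏ j ∈ s, y j +
        y i * ∑ s ∈ (Finset.univ.erase i).powersetCard m, ∏ j ∈ s, y j := by
    intro m y
    rw [esymmE, hU, Finset.powersetCard_succ_insert (Finset.notMem_erase i _),
      Finset.sum_union, Finset.sum_image, Finset.mul_sum]
    · rw [← hU]
      congr 1
      exact Finset.sum_congr rfl fun s hs => Finset.prod_insert (notMem_of_mem m s hs)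
    · intro s hs t ht hst
      rw [← Finset.erase_insert (notMem_of_mem m s hs), ← Finset.erase_insert
        (notMem_of_mem m t ht)]
      exact congrArg (fun u => Finset.erase u i) hst
    · rw [Finset.disjoint_left]
      intro s hs hs'
      obtain ⟨t, -, rfl⟩ := Finset.mem_image.1 hs'
      exact notMem_of_mem _ _ hs (Finset.mem_insert_self i t)
  have sum_update : ∀ m, ∑ s ∈ (Finset.univ.erase i).powersetCard m,
      ∏ j ∈ s, Function.update x i 0 j =
        ∑ s ∈ (Finset.univ.erase i).powersetCard m, ∏ j ∈ s, x j := by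
    refine fun m => Finset.sum_congr rfl fun s hs => Finset.prod_congr rfl fun j hj => ?_
    exact Function.update_of_ne (fun hji : j = i => notMem_of_mem m s hs (hji ▸ hj)) _ _
  have hk : esymmE n k (Function.update x i 0) =
      ∑ s ∈ (Finset.univ.erase i).powersetCard k, ∏ j ∈ s, x j := by
    cases k with
    | zero => simp [esymmE]
    | succ k => rw [expand, sum_update]; simp
  rw [hk, expand k x, expand k (Function.update x i 0), sum_update]
  simp [add_comm]

lemma sum_mul_esymmE_update_zero (n k : ℕ) (x : Fin n → ℝ) :
    ∑ i, x i * esymmE n k (Function.update x i 0) = (k + 1) * esymmE n (k + 1) x := by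
  have hterm : ∀ i, x i * esymmE n k (Function.update x i 0) =
      ∑ s ∈ (Finset.univ : Finset (Fin n)).powersetCard (k + 1),
        if i ∈ s then ∏ j ∈ s, x j else 0 := by
    intro i
    rw [eq_sub_of_add_eq (esymmE_succ_eq n k x i).symm, esymmE_update_zero, esymmE,
      ← Finset.sum_sub_distrib]
    exact Finset.sum_congr rfl fun s _ => by split_ifs <;> simp
  rw [Finset.sum_congr rfl fun i _ => hterm i, Finset.sum_comm, esymmE, Finset.mul_sum]
  refine Finset.sum_congr rfl fun s hs => ?_
  rw [← Finset.sum_filter, Finset.sum_const, Finset.filter_univ_mem,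
    (Finset.mem_powersetCard.1 hs).2]
  simp

lemma mem_gardingCone_succ {n r : ℕ} {x : Fin n → ℝ} :
    x ∈ gardingCone n (r + 1) ↔ x ∈ gardingCone n r ∧ 0 < esymmE n (r + 1) x := by
  refine ⟨fun h => ⟨fun k h1 h2 => h k h1 (by omega), h _ (by omega) le_rfl⟩,
    fun h k h1 h2 => ?_⟩
  rcases Nat.lt_or_eq_of_le h2 with h3 | rfl
  · exact h.1 k h1 (by omega)
  · exact h.2

lemma esymmE_pos_of_mem_gardingCone {n r : ℕ} {x : Fin n → ℝ} (hx : x ∈ gardingCone n r) :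
    0 < esymmE n r x := by
  cases r with
  | zero => simp [esymmE_zero]
  | succ r => exact (mem_gardingCone_succ.1 hx).2

/-- The next cone is the part of `gardingCone n r` on which the quotient is positive. -/
lemma convex_gardingCone_succ {n r : ℕ}
    (h : ConcaveOn ℝ (gardingCone n r) (fun x => esymmE n (r + 1) x / esymmE n r x)) :
    Convex ℝ (gardingCone n (r + 1)) := by
  refine (Set.ext fun x => ?_ : gardingCone n (r + 1) =
    {x ∈ gardingCone n r | 0 < esymmE n (r + 1) x / esymmE n r x}) ▸ h.convex_gt 0
  rw [mem_gardingCone_succ]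
  refine and_congr_right fun hx => ?_
  exact (div_pos_iff_of_pos_right (esymmE_pos_of_mem_gardingCone hx)).symm

/-- Concavity of `t ↦ (a + b t) / (c + d t)` at `0, 1, 2` determines the sign of its
determinant. -/
lemma mul_le_mul_of_midpoint_concave {a b c d : ℝ} (hc : 0 < c) (hd : 0 < d)
    (h : (1 / 2) * (a / c) + (1 / 2) * ((a + 2 * b) / (c + 2 * d)) ≤ (a + b) / (c + d)) :
    a * d ≤ b * c := by
  have key : (a + b) / (c + d) - ((1 / 2) * (a / c) + (1 / 2) * ((a + 2 * b) / (c + 2 * d))) =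
      (b * c - a * d) * (d / (c * (c + d) * (c + 2 * d))) := by
    field_simp
    ring
  have hnonneg : 0 ≤ (b * c - a * d) * (d / (c * (c + d) * (c + 2 * d))) := by linarith
  linarith [nonneg_of_mul_nonneg_left hnonneg (by positivity)]

lemma esymmE_update_add (n k : ℕ) (x : Fin n → ℝ) (i : Fin n) (t : ℝ) :
    esymmE n (k + 1) (Function.update x i (x i + t)) =
      esymmE n (k + 1) x + t * esymmE n k (Function.update x i 0) := by
  rw [esymmE_succ_eq n k _ i, esymmE_succ_eq n k x i]
  simp only [Function.update_self, Function.update_idem]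
  ring

/-- Inductive step for: deleting a coordinate maps each cone into the preceding one. -/
lemma esymmE_update_zero_pos_succ {n r : ℕ}
    (hconc : ConcaveOn ℝ (gardingCone n r) (fun x => esymmE n (r + 1) x / esymmE n r x))
    (hdel : ∀ x ∈ gardingCone n r, ∀ i, ∀ k < r, 0 < esymmE n k (Function.update x i 0))
    {x : Fin n → ℝ} (hx : x ∈ gardingCone n (r + 1)) (i : Fin n) :
    0 < esymmE n r (Function.update x i 0) := by
  cases r with
  | zero => simp [esymmE_zero]
  | succ r =>
    obtain ⟨hx', hpos⟩ := mem_gardingCone_succ.1 hx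
    have hd := hdel x hx' i r (by omega)
    have hc := esymmE_pos_of_mem_gardingCone hx'
    have hmem : ∀ t : ℝ, 0 ≤ t → Function.update x i (x i + t) ∈ gardingCone n (r + 1) := by
      intro t ht k h1 h2
      obtain ⟨k, rfl⟩ := Nat.exists_eq_add_of_le' h1
      rw [esymmE_update_add]
      exact add_pos_of_pos_of_nonneg (hx' _ h1 h2)
        (mul_nonneg ht (hdel x hx' i k (by omega)).le)
    have hmid := hconc.2 hx' (hmem 2 (by norm_num))
      (by norm_num : (0 : ℝ) ≤ 1 / 2) (by norm_num : (0 : ℝ) ≤ 1 / 2) (by norm_num)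
    have heq : (1 / 2 : ℝ) • x + (1 / 2 : ℝ) • Function.update x i (x i + 2) =
        Function.update x i (x i + 1) := by
      ext j
      rcases eq_or_ne j i with rfl | hj
      · simp; ring
      · simp [hj]; ring
    rw [heq] at hmid
    simp only [esymmE_update_add, smul_eq_mul, one_mul] at hmid
    have hle := mul_le_mul_of_midpoint_concave hc hd hmid
    exact pos_of_mul_pos_left (lt_of_lt_of_le (mul_pos hpos hd) hle) hc.le

lemma add_sq_div_le {a b p q u v w : ℝ} (ha : 0 ≤ a) (hb : 0 ≤ b) (hab : a + b = 1)
    (hu : 0 < u) (hv : 0 < v) (hw : a * u + b * v ≤ w) :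
    (a * p + b * q) ^ 2 / w ≤ a * (p ^ 2 / u) + b * (q ^ 2 / v) := by
  have hm : 0 < a * u + b * v := by
    rcases ha.eq_or_lt with rfl | ha
    · have : b = 1 := by linarith
      simpa [this] using hv
    · positivity
  refine (div_le_div_of_nonneg_left (sq_nonneg _) hm hw).trans ?_
  rw [div_le_iff₀ hm]
  have key : (a * (p ^ 2 / u) + b * (q ^ 2 / v)) * (a * u + b * v) - (a * p + b * q) ^ 2 =
      a * b * (p * v - q * u) ^ 2 / (u * v) := by
    field_simp
    ring
  have : 0 ≤ a * b * (p * v - q * u) ^ 2 / (u * v) := by positivity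
  linarith

lemma esymmE_quotient_eq {n r : ℕ} {x : Fin n → ℝ} (h : esymmE n (r + 1) x ≠ 0) :
    esymmE n (r + 2) x / esymmE n (r + 1) x = ((r : ℝ) + 2)⁻¹ *
      ∑ i, (x i - x i ^ 2 / (esymmE n (r + 1) x / esymmE n r (Function.update x i 0))) := by
  have hterm : ∀ i, x i - x i ^ 2 / (esymmE n (r + 1) x / esymmE n r (Function.update x i 0)) =
      x i * esymmE n (r + 1) (Function.update x i 0) / esymmE n (r + 1) x := by
    intro i
    have hsplit := esymmE_succ_eq n r x i
    rw [div_div_eq_mul_div, eq_div_iff h, sub_mul, div_mul_cancel₀ _ h]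
    linear_combination x i * hsplit
  rw [Finset.sum_congr rfl fun i _ => hterm i, ← Finset.sum_div, sum_mul_esymmE_update_zero]
  push_cast
  field_simp
  ring

lemma concaveOn_esymmE_quotient_succ {n r : ℕ}
    (hconc : ConcaveOn ℝ (gardingCone n r) (fun x => esymmE n (r + 1) x / esymmE n r x))
    (hdel : ∀ x ∈ gardingCone n (r + 1), ∀ i, ∀ k < r + 1,
      0 < esymmE n k (Function.update x i 0)) :
    ConcaveOn ℝ (gardingCone n (r + 1))
      (fun x => esymmE n (r + 2) x / esymmE n (r + 1) x) := by
  have hcv := convex_gardingCone_succ hconc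
  refine ⟨hcv, fun x hx y hy a b ha hb hab => ?_⟩
  have hz := hcv hx hy ha hb hab
  have hx0 := esymmE_pos_of_mem_gardingCone hx
  have hy0 := esymmE_pos_of_mem_gardingCone hy
  have hz0 := esymmE_pos_of_mem_gardingCone hz
  simp only [smul_eq_mul]
  rw [esymmE_quotient_eq hx0.ne', esymmE_quotient_eq hy0.ne', esymmE_quotient_eq hz0.ne',
    mul_left_comm a, mul_left_comm b, ← mul_add, Finset.mul_sum, Finset.mul_sum,
    ← Finset.sum_add_distrib]
  refine mul_le_mul_of_nonneg_left (Finset.sum_le_sum fun i _ => ?_) (by positivity)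
  have hmem : ∀ w ∈ gardingCone n (r + 1), Function.update w i 0 ∈ gardingCone n r :=
    fun w hw k _ hk => hdel w hw i k (by omega)
  have hdenom : ∀ w ∈ gardingCone n (r + 1),
      esymmE n (r + 1) w / esymmE n r (Function.update w i 0) =
        w i + esymmE n (r + 1) (Function.update w i 0) / esymmE n r (Function.update w i 0) := by
    intro w hw
    have := (hdel w hw i r (by omega)).ne'
    rw [esymmE_succ_eq n r w i]
    field_simp
  have hlin : a • Function.update x i 0 + b • Function.update y i 0 =
      Function.update (a • x + b • y) i 0 := by
    ext j
    rcases eq_or_ne j i with rfl | hj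
    · simp
    · simp [hj]
  have hq := hconc.2 (hmem x hx) (hmem y hy) ha hb hab
  rw [hlin] at hq
  simp only [smul_eq_mul] at hq
  have hle : a * (esymmE n (r + 1) x / esymmE n r (Function.update x i 0)) +
      b * (esymmE n (r + 1) y / esymmE n r (Function.update y i 0)) ≤
        esymmE n (r + 1) (a • x + b • y) /
          esymmE n r (Function.update (a • x + b • y) i 0) := by
    rw [hdenom x hx, hdenom y hy, hdenom _ hz]
    simp only [Pi.add_apply, Pi.smul_apply, smul_eq_mul]
    linarith
  have hsq := add_sq_div_le (p := x i) (q := y i) ha hb hab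
    (div_pos hx0 (hdel x hx i r (by omega))) (div_pos hy0 (hdel y hy i r (by omega))) hle
  simp only [Pi.add_apply, Pi.smul_apply, smul_eq_mul]
  linarith

lemma concaveOn_esymmE_quotient_and_update_zero_pos (n r : ℕ) :
    ConcaveOn ℝ (gardingCone n r) (fun x => esymmE n (r + 1) x / esymmE n r x) ∧
      ∀ x ∈ gardingCone n r, ∀ i, ∀ k < r, 0 < esymmE n k (Function.update x i 0) := by
  induction r with
  | zero =>
    refine ⟨⟨?_, fun x _ y _ a b _ _ _ => ?_⟩, fun _ _ _ k hk => absurd hk (Nat.not_lt_zero k)⟩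
    · have huniv : gardingCone n 0 = Set.univ :=
        Set.eq_univ_of_forall fun x k h1 h2 => by omega
      exact huniv ▸ convex_univ
    · simp [esymmE, Finset.powersetCard_one, Finset.sum_add_distrib, Finset.mul_sum]
  | succ r ih =>
    obtain ⟨hconc, hdel⟩ := ih
    have hdel' : ∀ x ∈ gardingCone n (r + 1), ∀ i, ∀ k < r + 1,
        0 < esymmE n k (Function.update x i 0) := by
      intro x hx i k hk
      rcases Nat.lt_succ_iff_lt_or_eq.1 hk with hk | rfl
      · exact hdel x (mem_gardingCone_succ.1 hx).1 i k hk
      · exact esymmE_update_zero_pos_succ hconc hdel hx i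
    exact ⟨concaveOn_esymmE_quotient_succ hconc hdel', hdel'⟩

/-- For `0 ≤ r ≤ n − 1`, the cone `Γ_r ⊂ ℝⁿ` is convex and the quotient
`Q_{r+1} = E_{r+1}/E_r` is concave on `Γ_r`. -/
theorem gardingCone_convex_and_quotient_concave (n : ℕ) (hn : 1 ≤ n) (r : ℕ)
    (hr : r ≤ n - 1) :
    Convex ℝ (gardingCone n r) ∧
      ConcaveOn ℝ (gardingCone n r) (fun x => esymmE n (r + 1) x / esymmE n r x) := by
  have h := (concaveOn_esymmE_quotient_and_update_zero_pos n r).1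
  exact ⟨h.1, h⟩
end

section
/- For every n ≥ 3, every integer r with 2 ≤ r ≤ n − 1, every index i ∈ {1,…,n}, and every λ ∈ Γ_r, the partial derivative of the quotient Q_r = E_r/E_{r−1} with respect to the i-th variable at λ is strictly positive. -/
open Polynomial in
/-- **Laguerre's inequality** for real polynomials with only real roots. -/
theorem Polynomial.Splits.laguerre_inequality {f : ℝ[X]} (hf : f.Splits) (t : ℝ) :
    f.eval t * (derivative (derivative f)).eval t ≤ (derivative f).eval t ^ 2 := by
  obtain ⟨s, hs⟩ := splits_iff_exists_multiset.mp hf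
  have key : ∀ s : Multiset ℝ,
      (s.map fun a => X - C a).prod.eval t *
        (derivative (derivative (s.map fun a => X - C a).prod)).eval t ≤
      (derivative (s.map fun a => X - C a).prod).eval t ^ 2 := by
    intro s
    induction s using Multiset.induction with
    | empty => simp
    | cons a s ih =>
      rw [Multiset.map_cons, Multiset.prod_cons]
      generalize (s.map fun a => X - C a).prod = g at ih ⊢
      simp only [derivative_mul, derivative_sub, derivative_X, derivative_C, derivative_add,
        eval_add, eval_mul, eval_sub, eval_X, eval_C, sub_zero, one_mul]
      nlinarith [mul_le_mul_of_nonneg_left ih (sq_nonneg (t - a)), sq_nonneg (g.eval t)]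
  rw [hs]
  simp only [derivative_C_mul, eval_mul, eval_C]
  nlinarith [mul_le_mul_of_nonneg_left (key s) (sq_nonneg f.leadingCoeff)]

open Polynomial in
/-- The derivative of a real polynomial with only real roots has only real roots. -/
theorem Polynomial.Splits.derivative_real {f : ℝ[X]} (hf : f.Splits) :
    (derivative f).Splits := by
  rw [splits_iff_card_roots] at hf ⊢
  have h₁ := card_roots_le_derivative f
  have h₂ := natDegree_derivative_le f
  have h₃ := card_roots' (derivative f)
  by_cases h : f.natDegree = 0
  · rw [derivative_of_natDegree_zero h]
    simp
  · omega

open Polynomial in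
/-- **Newton's inequality** for the coefficients of a real polynomial with only real roots. -/
theorem Polynomial.Splits.newton_coeff {f : ℝ[X]} (hf : f.Splits) (m : ℕ) :
    ((m : ℝ) + 2) * (f.coeff m * f.coeff (m + 2)) ≤ (m + 1) * f.coeff (m + 1) ^ 2 := by
  have hs : ∀ k : ℕ, (derivative^[k] f).Splits := fun k => by
    induction k with
    | zero => exact hf
    | succ k ih => rw [Function.iterate_succ_apply']; exact ih.derivative_real
  have h := (hs m).laguerre_inequality 0
  rw [← Function.iterate_succ_apply' (derivative (R := ℝ)),
    ← Function.iterate_succ_apply' (derivative (R := ℝ))] at h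
  simp only [← coeff_zero_eq_eval_zero, coeff_iterate_derivative, zero_add,
    Nat.descFactorial_self, nsmul_eq_mul, Nat.succ_eq_add_one, Nat.factorial_succ] at h
  push_cast at h
  have hm : (0 : ℝ) < (m.factorial : ℝ) ^ 2 * (m + 1) := by positivity
  refine le_of_mul_le_mul_left ?_ hm
  linear_combination h

open Polynomial in
/-- A strict form of **Newton's inequality** for elementary symmetric functions. -/
theorem Finset.exists_one_lt_mul_esymm_le_sq {ι : Type*} (S : Finset ι) (x : ι → ℝ) (k : ℕ) :
    ∃ c : ℝ, 1 < c ∧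
      c * ((∑ s ∈ S.powersetCard k, ∏ j ∈ s, x j) *
        ∑ s ∈ S.powersetCard (k + 2), ∏ j ∈ s, x j) ≤
      (∑ s ∈ S.powersetCard (k + 1), ∏ j ∈ s, x j) ^ 2 := by
  rcases lt_or_ge S.card (k + 2) with h | h
  · refine ⟨2, one_lt_two, ?_⟩
    rw [Finset.powersetCard_eq_empty.mpr h, Finset.sum_empty, mul_zero, mul_zero]
    exact sq_nonneg _
  · obtain ⟨m, hm⟩ := Nat.exists_eq_add_of_le' h
    have hf : (∏ j ∈ S, (X + C (x j))).Splits := Splits.prod fun j _ => Splits.X_add_C _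
    have key := hf.newton_coeff m
    rw [Finset.prod_X_add_C_coeff S x (by omega), Finset.prod_X_add_C_coeff S x (by omega),
      Finset.prod_X_add_C_coeff S x (by omega), show S.card - m = k + 2 by omega,
      show S.card - (m + 2) = k by omega, show S.card - (m + 1) = k + 1 by omega] at key
    have hpos : (0 : ℝ) < m + 1 := by positivity
    refine ⟨(m + 2) / (m + 1), by rw [one_lt_div hpos]; linarith, ?_⟩
    rw [div_mul_eq_mul_div, div_le_iff₀ hpos]
    linear_combination key

/-- Expansion of an elementary symmetric function along one variable. -/
theorem esymmE_succ_update (n k : ℕ) (x : Fin n → ℝ) (i : Fin n) (t : ℝ) :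
    esymmE n (k + 1) (Function.update x i t) =
      (∑ s ∈ (Finset.univ.erase i).powersetCard (k + 1), ∏ j ∈ s, x j) +
        t * ∑ s ∈ (Finset.univ.erase i).powersetCard k, ∏ j ∈ s, x j := by
  have hi : i ∉ (Finset.univ : Finset (Fin n)).erase i := Finset.notMem_erase _ _
  have hnot : ∀ l, ∀ s ∈ ((Finset.univ : Finset (Fin n)).erase i).powersetCard l, i ∉ s :=
    fun l s hs h => hi ((Finset.mem_powersetCard.mp hs).1 h)
  have hprod : ∀ l, ∀ s ∈ ((Finset.univ : Finset (Fin n)).erase i).powersetCard l,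
      ∏ j ∈ s, Function.update x i t j = ∏ j ∈ s, x j := fun l s hs =>
    Finset.prod_congr rfl fun j hj =>
      Function.update_of_ne (ne_of_mem_of_not_mem hj (hnot l s hs)) _ _
  rw [esymmE, ← Finset.insert_erase (Finset.mem_univ i), Finset.powersetCard_succ_insert hi,
    Finset.sum_union, Finset.sum_image, Finset.insert_erase (Finset.mem_univ i),
    Finset.sum_congr rfl (hprod _), Finset.mul_sum]
  · congr 1
    refine Finset.sum_congr rfl fun s hs => ?_
    rw [Finset.prod_insert (hnot k s hs), Function.update_self, hprod k s hs]
  · intro s hs u hu h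
    rw [← Finset.erase_insert (hnot k s hs), ← Finset.erase_insert (hnot k u hu)]
    exact congrArg (fun v => v.erase i) h
  · rw [Finset.disjoint_left]
    intro s hs hs'
    obtain ⟨u, -, rfl⟩ := Finset.mem_image.mp hs'
    exact hnot _ _ hs (Finset.mem_insert_self _ _)

theorem esymm_erase_pos_of_mem_gardingCone {n r : ℕ} {x : Fin n → ℝ} (hx : x ∈ gardingCone n r)
    (i : Fin n) (k : ℕ) (hk : k + 1 ≤ r) :
    0 < ∑ s ∈ (Finset.univ.erase i).powersetCard k, ∏ j ∈ s, x j := by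
  induction k with
  | zero => simp
  | succ k ih =>
    specialize ih (by omega)
    have h₁ := hx (k + 1) (by omega) (by omega)
    have h₂ := hx (k + 2) (by omega) (by omega)
    rw [← Function.update_eq_self i x, esymmE_succ_update] at h₁ h₂
    obtain ⟨c, hc, hN⟩ := Finset.exists_one_lt_mul_esymm_le_sq (Finset.univ.erase i) x k
    generalize (∑ s ∈ (Finset.univ.erase i).powersetCard k, ∏ j ∈ s, x j) = a at *
    generalize (∑ s ∈ (Finset.univ.erase i).powersetCard (k + 1), ∏ j ∈ s, x j) = b at *
    generalize (∑ s ∈ (Finset.univ.erase i).powersetCard (k + 2), ∏ j ∈ s, x j) = d at *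
    by_contra! hb
    have h₃ : -b * b + (-b) * (x i * a) ≥ 0 := by nlinarith
    have h₄ : 0 < a * d + a * (x i * b) := by nlinarith
    have h₅ : 0 < a * d := by nlinarith [sq_nonneg b]
    nlinarith

/-- For `2 ≤ r ≤ n − 1` and `λ ∈ Γ_r`, the partial derivative of `Q_r = E_r/E_{r−1}`
with respect to the `i`-th variable at `λ` is strictly positive. -/
theorem quotient_partial_deriv_pos (n : ℕ) (hn : 3 ≤ n) (r : ℕ) (hr2 : 2 ≤ r)
    (hrn : r ≤ n - 1) (i : Fin n) (x : Fin n → ℝ) (hx : x ∈ gardingCone n r) :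
    0 < deriv (fun t : ℝ =>
        esymmE n r (Function.update x i t) / esymmE n (r - 1) (Function.update x i t)) (x i) := by
  obtain ⟨k, rfl⟩ := Nat.exists_eq_add_of_le' hr2
  have hE : 0 < esymmE n (k + 1) (Function.update x i (x i)) := by
    rw [Function.update_eq_self]
    exact hx (k + 1) (by omega) (by omega)
  have hb := esymm_erase_pos_of_mem_gardingCone hx i (k + 1) (by omega)
  obtain ⟨c, hc, hN⟩ := Finset.exists_one_lt_mul_esymm_le_sq (Finset.univ.erase i) x k
  simp only [show k + 2 - 1 = k + 1 by omega, esymmE_succ_update] at hE ⊢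
  generalize (∑ s ∈ (Finset.univ.erase i).powersetCard k, ∏ j ∈ s, x j) = a at *
  generalize (∑ s ∈ (Finset.univ.erase i).powersetCard (k + 1), ∏ j ∈ s, x j) = b at *
  generalize (∑ s ∈ (Finset.univ.erase i).powersetCard (k + 2), ∏ j ∈ s, x j) = d at *
  have hlin : ∀ u v : ℝ, HasDerivAt (fun t : ℝ => u + t * v) v (x i) := fun u v => by
    simpa using ((hasDerivAt_id (x i)).mul_const v).const_add u
  rw [((hlin d b).fun_div (hlin b a) hE.ne').deriv]
  refine div_pos ?_ (by positivity)
  have hstrict : a * d < b ^ 2 := by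
    rcases le_or_gt (a * d) 0 with h | h
    · exact h.trans_lt (by positivity)
    · exact (lt_mul_of_one_lt_left h hc).trans_le hN
  linear_combination hstrict
end

section
/- For every n ≥ 1, every integer r with 1 ≤ r ≤ n, and every λ ∈ ℝⁿ with E_{r−1}(λ) ≠ 0, the quotient Q_r = E_r/E_{r−1} satisfies Σ_{i=1}^{n} λ_i² · (∂Q_r/∂λ_i)(λ) = r·Q_r(λ)² − (r + 1)·E_{r+1}(λ)/E_{r−1}(λ), where ∂Q_r/∂λ_i denotes the partial derivative with respect to the i-th variable. -/
/-- The partial derivative `∂E_r/∂λ_i`, as the sum of the `i`-free cofactors. -/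
noncomputable def esymmPartial (n r : ℕ) (x : Fin n → ℝ) (i : Fin n) : ℝ :=
  ∑ s ∈ (Finset.univ : Finset (Fin n)).powersetCard r with i ∈ s, ∏ j ∈ s.erase i, x j

theorem hasDerivAt_prod_update {ι : Type*} [DecidableEq ι] (s : Finset ι) (x : ι → ℝ) (i : ι)
    (t : ℝ) :
    HasDerivAt (fun t : ℝ => ∏ j ∈ s, Function.update x i t j)
      (if i ∈ s then ∏ j ∈ s.erase i, x j else 0) t := by
  split_ifs with h
  · have key : (fun t : ℝ => ∏ j ∈ s, Function.update x i t j)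
        = fun t => t * ∏ j ∈ s.erase i, x j := by
      funext t
      rw [← Finset.mul_prod_erase s _ h, Function.update_self]
      congr 1
      exact Finset.prod_congr rfl fun j hj => Function.update_of_ne (Finset.ne_of_mem_erase hj) _ _
    rw [key]
    simpa using (hasDerivAt_id t).mul_const (∏ j ∈ s.erase i, x j)
  · have key : (fun t : ℝ => ∏ j ∈ s, Function.update x i t j) = fun _ => ∏ j ∈ s, x j := by
      funext t
      exact Finset.prod_update_of_notMem h _ _
    rw [key]
    exact hasDerivAt_const _ _

theorem hasDerivAt_esymmE_update (n r : ℕ) (x : Fin n → ℝ) (i : Fin n) (t : ℝ) :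
    HasDerivAt (fun t : ℝ => esymmE n r (Function.update x i t)) (esymmPartial n r x i) t := by
  unfold esymmE esymmPartial
  rw [Finset.sum_filter]
  exact HasDerivAt.fun_sum fun s _ => hasDerivAt_prod_update s x i t

theorem mul_esymmPartial (n r : ℕ) (x : Fin n → ℝ) (i : Fin n) :
    x i * esymmPartial n r x i
      = ∑ s ∈ (Finset.univ : Finset (Fin n)).powersetCard r with i ∈ s, ∏ j ∈ s, x j := by
  rw [esymmPartial, Finset.mul_sum]
  exact Finset.sum_congr rfl fun s hs => Finset.mul_prod_erase s x (Finset.mem_filter.1 hs).2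

/-- Euler's relation for the homogeneous polynomial `E_r`. -/
theorem sum_mul_esymmPartial (n r : ℕ) (x : Fin n → ℝ) :
    ∑ i, x i * esymmPartial n r x i = r * esymmE n r x := by
  simp_rw [mul_esymmPartial, Finset.sum_filter]
  rw [Finset.sum_comm, esymmE, Finset.mul_sum]
  refine Finset.sum_congr rfl fun s hs => ?_
  simp [(Finset.mem_powersetCard.1 hs).2]

theorem esymmPartial_succ (n r : ℕ) (x : Fin n → ℝ) (i : Fin n) :
    esymmPartial n (r + 1) x i
      = ∑ s ∈ (Finset.univ : Finset (Fin n)).powersetCard r with i ∉ s, ∏ j ∈ s, x j := by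
  rw [esymmPartial]
  refine Finset.sum_nbij' (fun s => s.erase i) (fun s => insert i s) ?_ ?_ ?_ ?_ ?_
  · intro s hs
    simp only [Finset.mem_filter, Finset.mem_powersetCard_univ] at hs ⊢
    simp [Finset.card_erase_of_mem hs.2, hs.1]
  · intro s hs
    simp only [Finset.mem_filter, Finset.mem_powersetCard_univ] at hs ⊢
    simp [Finset.card_insert_of_notMem hs.2, hs.1]
  · exact fun s hs => Finset.insert_erase (Finset.mem_filter.1 hs).2
  · exact fun s hs => Finset.erase_insert (Finset.mem_filter.1 hs).2
  · exact fun _ _ => rfl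

theorem esymmE_eq_mul_esymmPartial_add (n r : ℕ) (x : Fin n → ℝ) (i : Fin n) :
    esymmE n r x = x i * esymmPartial n r x i + esymmPartial n (r + 1) x i := by
  rw [mul_esymmPartial, esymmPartial_succ, Finset.sum_filter_add_sum_filter_not, esymmE]

theorem sum_sq_mul_esymmPartial (n r : ℕ) (x : Fin n → ℝ) :
    ∑ i, x i ^ 2 * esymmPartial n r x i
      = (∑ i, x i) * esymmE n r x - (r + 1) * esymmE n (r + 1) x := by
  have h := sum_mul_esymmPartial n (r + 1) x
  push_cast at h
  rw [← h, Finset.sum_mul, ← Finset.sum_sub_distrib]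
  refine Finset.sum_congr rfl fun i _ => ?_
  rw [esymmE_eq_mul_esymmPartial_add n r x i]
  ring

/-- `∑_{i=1}^{n} λ_i² · (∂Q_r/∂λ_i)(λ) = r·Q_r(λ)² − (r + 1)·E_{r+1}(λ)/E_{r−1}(λ)`
wherever `E_{r−1}(λ) ≠ 0`. -/
theorem quotient_sq_euler_relation (n : ℕ) (hn : 1 ≤ n) (r : ℕ) (hr1 : 1 ≤ r) (hrn : r ≤ n)
    (x : Fin n → ℝ) (hx : esymmE n (r - 1) x ≠ 0) :
    ∑ i : Fin n, (x i) ^ 2 * deriv (fun t : ℝ =>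
        esymmE n r (Function.update x i t) / esymmE n (r - 1) (Function.update x i t)) (x i)
      = (r : ℝ) * (esymmE n r x / esymmE n (r - 1) x) ^ 2
        - ((r : ℝ) + 1) * esymmE n (r + 1) x / esymmE n (r - 1) x := by
  have hderiv (i : Fin n) : deriv (fun t : ℝ =>
      esymmE n r (Function.update x i t) / esymmE n (r - 1) (Function.update x i t)) (x i)
      = (esymmPartial n r x i * esymmE n (r - 1) x - esymmE n r x * esymmPartial n (r - 1) x i)
        / esymmE n (r - 1) x ^ 2 := by
    have h := (hasDerivAt_esymmE_update n r x i (x i)).fun_div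
      (hasDerivAt_esymmE_update n (r - 1) x i (x i)) (by rwa [Function.update_eq_self])
    simpa only [Function.update_eq_self] using h.deriv
  have hsum : ∑ i, x i ^ 2 * ((esymmPartial n r x i * esymmE n (r - 1) x
        - esymmE n r x * esymmPartial n (r - 1) x i) / esymmE n (r - 1) x ^ 2)
      = ((∑ i, x i ^ 2 * esymmPartial n r x i) * esymmE n (r - 1) x
        - esymmE n r x * ∑ i, x i ^ 2 * esymmPartial n (r - 1) x i) / esymmE n (r - 1) x ^ 2 := by
    rw [Finset.sum_mul, Finset.mul_sum, ← Finset.sum_sub_distrib, Finset.sum_div]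
    exact Finset.sum_congr rfl fun i _ => by ring
  simp_rw [hderiv]
  rw [hsum, sum_sq_mul_esymmPartial, sum_sq_mul_esymmPartial, Nat.sub_add_cancel hr1,
    Nat.cast_sub hr1, Nat.cast_one, sub_add_cancel]
  field_simp
  ring
end

section
/- Let n ≥ 1 be an integer, T ∈ (0, ∞], and let Φ : ℝ → ℝ be continuous on (0, ∞), strictly positive on (0, ∞), and monotone nondecreasing on (0, ∞). Define G(x) = ∫₀ˣ 1/Φ(1/s) ds for x > 0. Let h : [0, T) → ℝ be differentiable with h(t) > 0 and h'(t) ≥ (1/n)·Φ(h(t))·h(t)² for all t ∈ [0, T). Then for every t ∈ [0, T) one has G(1/h(t)) ≤ G(1/h(0)) − t/n; in particular, since G(1/h(t)) > 0, it follows that T ≤ n·G(1/h(0)). -/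
open Set

/-- `G(x) = ∫₀ˣ 1/Φ(1/s) ds`. -/
noncomputable def Gfun (Φ : ℝ → ℝ) (x : ℝ) : ℝ :=
  ∫ s in (0 : ℝ)..x, 1 / Φ (1 / s)

open MeasureTheory

section Gfun

variable {Φ : ℝ → ℝ}

theorem continuousOn_one_div_comp_one_div (hΦc : ContinuousOn Φ (Ioi 0))
    (hΦpos : ∀ x ∈ Ioi (0 : ℝ), 0 < Φ x) :
    ContinuousOn (fun s : ℝ => 1 / Φ (1 / s)) (Ioi 0) := by
  have hinv : ContinuousOn (fun s : ℝ => 1 / s) (Ioi 0) :=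
    continuousOn_const.div continuousOn_id fun s hs => (mem_Ioi.mp hs).ne'
  have hmaps : MapsTo (fun s : ℝ => 1 / s) (Ioi 0) (Ioi 0) := fun s hs =>
    one_div_pos.mpr (mem_Ioi.mp hs)
  exact continuousOn_const.div (hΦc.comp hinv hmaps) fun s hs => (hΦpos _ (hmaps hs)).ne'

theorem intervalIntegrable_one_div_comp_one_div (hΦc : ContinuousOn Φ (Ioi 0))
    (hΦpos : ∀ x ∈ Ioi (0 : ℝ), 0 < Φ x) (hΦmono : MonotoneOn Φ (Ioi 0)) {x : ℝ} (hx : 0 < x) :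
    IntervalIntegrable (fun s : ℝ => 1 / Φ (1 / s)) volume 0 x := by
  rw [intervalIntegrable_iff_integrableOn_Ioc_of_le hx.le]
  refine IntegrableOn.of_bound measure_Ioc_lt_top
    (((continuousOn_one_div_comp_one_div hΦc hΦpos).mono
      Ioc_subset_Ioi_self).aestronglyMeasurable measurableSet_Ioc) (1 / Φ (1 / x)) ?_
  refine (ae_restrict_iff' measurableSet_Ioc).mpr (Filter.Eventually.of_forall fun s hs => ?_)
  have hs' : 0 < 1 / s := one_div_pos.mpr hs.1
  have hx' : 0 < 1 / x := one_div_pos.mpr hx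
  rw [Real.norm_of_nonneg (one_div_pos.mpr (hΦpos _ hs')).le]
  exact one_div_le_one_div_of_le (hΦpos _ hx')
    (hΦmono hx' hs' (one_div_le_one_div_of_le hs.1 hs.2))

theorem Gfun_pos (hΦc : ContinuousOn Φ (Ioi 0)) (hΦpos : ∀ x ∈ Ioi (0 : ℝ), 0 < Φ x)
    (hΦmono : MonotoneOn Φ (Ioi 0)) {x : ℝ} (hx : 0 < x) : 0 < Gfun Φ x :=
  intervalIntegral.intervalIntegral_pos_of_pos_on
    (intervalIntegrable_one_div_comp_one_div hΦc hΦpos hΦmono hx)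
    (fun _ hs => one_div_pos.mpr (hΦpos _ (one_div_pos.mpr hs.1))) hx

theorem hasDerivAt_Gfun (hΦc : ContinuousOn Φ (Ioi 0)) (hΦpos : ∀ x ∈ Ioi (0 : ℝ), 0 < Φ x)
    (hΦmono : MonotoneOn Φ (Ioi 0)) {x : ℝ} (hx : 0 < x) :
    HasDerivAt (Gfun Φ) (1 / Φ (1 / x)) x := by
  have hc := continuousOn_one_div_comp_one_div hΦc hΦpos
  exact intervalIntegral.integral_hasDerivAt_right
    (intervalIntegrable_one_div_comp_one_div hΦc hΦpos hΦmono hx)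
    (hc.stronglyMeasurableAtFilter isOpen_Ioi x hx) (hc.continuousAt (Ioi_mem_nhds hx))

end Gfun

/-- ODE comparison: if `h > 0` and `h' ≥ (1/n)·Φ(h)·h²` on `[0,T)`, then
`G(1/h(t)) ≤ G(1/h(0)) − t/n` for all `t ∈ [0,T)`, and `T ≤ n·G(1/h(0))`. -/
theorem ode_comparison_lower (n : ℕ) (hn : 1 ≤ n) (T : ENNReal) (hT : 0 < T)
    (Φ : ℝ → ℝ) (hΦc : ContinuousOn Φ (Ioi 0)) (hΦpos : ∀ x ∈ Ioi (0 : ℝ), 0 < Φ x)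
    (hΦmono : MonotoneOn Φ (Ioi 0)) (h h' : ℝ → ℝ)
    (hderiv : ∀ t : ℝ, 0 ≤ t → ENNReal.ofReal t < T → HasDerivAt h (h' t) t)
    (hpos : ∀ t : ℝ, 0 ≤ t → ENNReal.ofReal t < T → 0 < h t)
    (hineq : ∀ t : ℝ, 0 ≤ t → ENNReal.ofReal t < T →
      (1 / (n : ℝ)) * Φ (h t) * (h t) ^ 2 ≤ h' t) :
    (∀ t : ℝ, 0 ≤ t → ENNReal.ofReal t < T →
        Gfun Φ (1 / h t) ≤ Gfun Φ (1 / h 0) - t / n) ∧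
      T ≤ ENNReal.ofReal ((n : ℝ) * Gfun Φ (1 / h 0)) := by
  have hn' : (0 : ℝ) < n := by exact_mod_cast hn
  have main : ∀ t : ℝ, 0 ≤ t → ENNReal.ofReal t < T →
      Gfun Φ (1 / h t) ≤ Gfun Φ (1 / h 0) - t / n := by
    intro t ht htT
    have hlt : ∀ s ∈ Icc 0 t, ENNReal.ofReal s < T := fun s hs =>
      (ENNReal.ofReal_le_ofReal hs.2).trans_lt htT
    have hd : ∀ s ∈ Icc 0 t, HasDerivAt (fun s => Gfun Φ (1 / h s) + s / n)
        (1 / Φ (h s) * (-h' s / h s ^ 2) + 1 / n) s := by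
      intro s hs
      have hh := hpos s hs.1 (hlt s hs)
      have hG := hasDerivAt_Gfun hΦc hΦpos hΦmono (one_div_pos.mpr hh)
      rw [one_div_one_div] at hG
      have hinv : HasDerivAt (fun s => 1 / h s) (-h' s / h s ^ 2) s := by
        simpa only [one_div] using (hderiv s hs.1 (hlt s hs)).fun_inv hh.ne'
      exact (hG.comp s hinv).add ((hasDerivAt_id s).div_const _)
    have hanti : AntitoneOn (fun s => Gfun Φ (1 / h s) + s / n) (Icc 0 t) := by
      refine antitoneOn_of_hasDerivWithinAt_nonpos (convex_Icc 0 t)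
        (fun s hs => (hd s hs).continuousAt.continuousWithinAt)
        (fun s hs => (hd s (interior_subset hs)).hasDerivWithinAt) fun s hs => ?_
      have hs := interior_subset hs
      have hh := hpos s hs.1 (hlt s hs)
      have hΦ := hΦpos _ hh
      have key : 1 / (n : ℝ) ≤ h' s / (Φ (h s) * h s ^ 2) := by
        rw [le_div_iff₀ (by positivity), ← mul_assoc]
        exact hineq s hs.1 (hlt s hs)
      have heq : 1 / Φ (h s) * (-h' s / h s ^ 2) = -(h' s / (Φ (h s) * h s ^ 2)) := by
        field_simp
      rw [heq]
      linarith
    have hle := hanti (left_mem_Icc.mpr ht) (right_mem_Icc.mpr ht) ht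
    simp only [zero_div, add_zero] at hle
    linarith
  refine ⟨main, ?_⟩
  by_contra! hlt
  have h0 : 0 < h 0 := hpos 0 le_rfl (by simpa using hT)
  have hG0 := Gfun_pos hΦc hΦpos hΦmono (one_div_pos.mpr h0)
  have hc := (mul_pos hn' hG0).le
  have hle := main _ hc hlt
  rw [mul_div_cancel_left₀ _ hn'.ne', sub_self] at hle
  exact hle.not_gt (Gfun_pos hΦc hΦpos hΦmono (one_div_pos.mpr (hpos _ hc hlt)))
end

section
/- Let β₁ > 0, β₃ > 0 and β₂ ≥ 1, and define Φ(x) = β₁·(sinh x)^{β₂} + β₃ for x > 0 (real power of the hyperbolic sine). Then for every x > 0: Φ(x) > 0; Φ'(x) > 0; Φ''(x) ≥ −2Φ'(x)/x; and Φ(x)Φ''(x)x + Φ(x)Φ'(x) − (Φ'(x))²x ≥ 0. Here Φ' and Φ'' denote the first and second derivatives of Φ. -/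
theorem hasDerivAt_mul_sinh_rpow_add (b p c : ℝ) {x : ℝ} (hx : x ≠ 0) :
    HasDerivAt (fun y : ℝ => b * Real.sinh y ^ p + c)
      (b * (Real.cosh x * p * Real.sinh x ^ (p - 1))) x :=
  (((Real.hasDerivAt_sinh x).rpow_const (Or.inl (Real.sinh_ne_zero.mpr hx))).const_mul b).add_const c

theorem deriv_deriv_mul_sinh_rpow_add (b p c : ℝ) {x : ℝ} (hx : x ≠ 0) :
    deriv (deriv (fun y : ℝ => b * Real.sinh y ^ p + c)) x =
      b * (Real.sinh x * p * Real.sinh x ^ (p - 1) +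
        Real.cosh x * p * (Real.cosh x * (p - 1) * Real.sinh x ^ (p - 1 - 1))) := by
  have h : deriv (fun y : ℝ => b * Real.sinh y ^ p + c) =ᶠ[nhds x]
      fun y => b * (Real.cosh y * p * Real.sinh y ^ (p - 1)) := by
    filter_upwards [isOpen_ne.mem_nhds hx] with y hy
    exact (hasDerivAt_mul_sinh_rpow_add b p c hy).deriv
  rw [h.deriv_eq]
  exact ((((Real.hasDerivAt_cosh x).mul_const p).mul
    ((Real.hasDerivAt_sinh x).rpow_const (Or.inl (Real.sinh_ne_zero.mpr hx)))).const_mul b).deriv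

/-- Example 1.3(ii)(1): `Φ(x) = β₁ sinh^{β₂}(x) + β₃` with `β₁, β₃ > 0`, `β₂ ≥ 1` satisfies
Assumption 1.1 on `(0,∞)`: `Φ > 0`, `Φ' > 0`, `Φ'' ≥ −2Φ'/x` and
`ΦΦ''x + ΦΦ' − (Φ')²x ≥ 0`. -/
theorem sinh_example_assumptions (β₁ β₂ β₃ : ℝ) (hβ₁ : 0 < β₁) (hβ₃ : 0 < β₃) (hβ₂ : 1 ≤ β₂) :
    ∀ x : ℝ, 0 < x →
      (0 < β₁ * Real.sinh x ^ β₂ + β₃) ∧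
      (0 < deriv (fun y : ℝ => β₁ * Real.sinh y ^ β₂ + β₃) x) ∧
      (-2 * deriv (fun y : ℝ => β₁ * Real.sinh y ^ β₂ + β₃) x / x ≤
        deriv (deriv (fun y : ℝ => β₁ * Real.sinh y ^ β₂ + β₃)) x) ∧
      (0 ≤ (β₁ * Real.sinh x ^ β₂ + β₃)
            * deriv (deriv (fun y : ℝ => β₁ * Real.sinh y ^ β₂ + β₃)) x * x
          + (β₁ * Real.sinh x ^ β₂ + β₃)
            * deriv (fun y : ℝ => β₁ * Real.sinh y ^ β₂ + β₃) x
          - (deriv (fun y : ℝ => β₁ * Real.sinh y ^ β₂ + β₃) x) ^ 2 * x) := by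
  intro x hx
  rw [deriv_deriv_mul_sinh_rpow_add β₁ β₂ β₃ hx.ne',
    (hasDerivAt_mul_sinh_rpow_add β₁ β₂ β₃ hx.ne').deriv]
  have hs : 0 < Real.sinh x := Real.sinh_pos_iff.mpr hx
  have hC : 0 < Real.cosh x := Real.cosh_pos x
  have hsC : x ≤ Real.sinh x * Real.cosh x :=
    (Real.self_le_sinh_iff.mpr hx.le).trans
      (le_mul_of_one_le_right hs.le (Real.one_le_cosh x))
  have hsq : Real.cosh x ^ 2 = Real.sinh x ^ 2 + 1 := Real.cosh_sq x
  have hA : 0 < Real.sinh x ^ (β₂ - 1 - 1) := Real.rpow_pos_of_pos hs _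
  have h₁ : Real.sinh x ^ (β₂ - 1) = Real.sinh x ^ (β₂ - 1 - 1) * Real.sinh x := by
    rw [← Real.rpow_add_one hs.ne', sub_add_cancel]
  have h₀ : Real.sinh x ^ β₂ = Real.sinh x ^ (β₂ - 1 - 1) * Real.sinh x * Real.sinh x := by
    rw [← h₁, ← Real.rpow_add_one hs.ne', sub_add_cancel]
  rw [h₀, h₁]
  generalize Real.sinh x ^ (β₂ - 1 - 1) = A at hA
  generalize Real.sinh x = s at *
  generalize Real.cosh x = C at *
  have hp : 0 < β₂ := by linarith
  have hp₁ : 0 ≤ β₂ - 1 := by linarith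
  have hd : 0 < β₁ * (C * β₂ * (A * s)) := by positivity
  have hdd : 0 ≤ β₁ * (s * β₂ * (A * s) + C * β₂ * (C * (β₂ - 1) * A)) := by positivity
  refine ⟨by positivity, hd, ?_, ?_⟩
  · refine le_trans (div_nonpos_of_nonpos_of_nonneg ?_ hx.le) hdd
    linarith
  · have hsC' : 0 ≤ s * C - x := by linarith
    calc (0 : ℝ) ≤ β₃ * (β₁ * (s * β₂ * (A * s) + C * β₂ * (C * (β₂ - 1) * A)) * x
            + β₁ * (C * β₂ * (A * s)))
          + β₁ ^ 2 * β₂ * A ^ 2 * s ^ 2 * (s * C - x) := by positivity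
      _ = _ := by linear_combination (β₁ ^ 2 * β₂ * A ^ 2 * s ^ 2 * x) * hsq
end
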